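/- Let p be a prime, a ≥ 1, F a field of characteristic p, R = F[λ_1,...,λ_a]/(λ_1^p,...,λ_a^p) with augmentation ideal I = (λ_1,...,λ_a), and K_* the Koszul complex of R on (λ_1,...,λ_a). Let λ ∈ I and let z ∈ K_1 be any element with d(z) = λ. Then λ^{p-1}·z is a cycle whose homology class in H_1(K_*) is μ_1^p[λ_1^{p-1}z_1] + ... + μ_a^p[λ_a^{p-1}z_a], where μ_i ∈ F are determined by λ ≡ μ_1λ_1 + ... + μ_aλ_a (mod I^2). In particular the class is independent of the choice of z. -/

import Mathlib

set_option synthInstance.maxHeartbeats 1000000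
set_option maxHeartbeats 2000000

noncomputable section

/-- The relations ideal `(X_1^p, …, X_a^p)` defining the truncated polynomial ring. -/
def KoszulJ (p a : ℕ) (F : Type*) [Field F] : Ideal (MvPolynomial (Fin a) F) :=
  Ideal.span (Set.range fun i : Fin a => MvPolynomial.X i ^ p)

/-- The truncated polynomial ring `R = F[λ_1, …, λ_a]/(λ_1^p, …, λ_a^p)`. -/
abbrev KoszulR (p a : ℕ) (F : Type*) [Field F] : Type _ :=
  MvPolynomial (Fin a) F ⧸ KoszulJ p a F

/-- The generators `λ_i` of the maximal ideal of `R`. -/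
def Koszullam (p a : ℕ) (F : Type*) [Field F] (i : Fin a) : KoszulR p a F :=
  Ideal.Quotient.mk (KoszulJ p a F) (MvPolynomial.X i)

/-- The underlying module of the Koszul complex of `(λ_1, …, λ_a)`: the free `R`-module with
basis `z_s` indexed by subsets `s ⊆ {1, …, a}`; its degree-`n` part is spanned by the `z_s`
with `|s| = n`. -/
abbrev KoszulM (p a : ℕ) (F : Type*) [Field F] : Type _ :=
  Finset (Fin a) →₀ KoszulR p a F

/-- The boundary of a basis element: `d z_s = ∑_{i ∈ s} (-1)^{|{j ∈ s : j < i}|} λ_i z_{s∖i}`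
(so that `d z_{\{i\}} = λ_i z_∅`). -/
def Koszulbd (p a : ℕ) (F : Type*) [Field F] (s : Finset (Fin a)) : KoszulM p a F :=
  ∑ i ∈ s, ((-1 : ℤ) ^ ((s.filter fun j => j < i).card)) •
    Koszullam p a F i • Finsupp.single (s.erase i) (1 : KoszulR p a F)

/-- The Koszul differential, as an `R`-linear endomorphism of `⊕_s R·z_s`. -/
def KoszulD (p a : ℕ) (F : Type*) [Field F] : KoszulM p a F →ₗ[KoszulR p a F] KoszulM p a F :=
  Finsupp.lsum (KoszulR p a F) fun s => LinearMap.smulRight LinearMap.id (Koszulbd p a F s)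

/-- The `F`-submodule of elements supported in homological degree `n`. -/
def KoszulSupp (p a : ℕ) (F : Type*) [Field F] (n : ℕ) : Submodule F (KoszulM p a F) :=
  Submodule.restrictScalars F
    (Finsupp.supported (KoszulR p a F) (KoszulR p a F) {s : Finset (Fin a) | s.card = n})

/-- The `n`-cycles of the Koszul complex. -/
def KoszulZ (p a : ℕ) (F : Type*) [Field F] (n : ℕ) : Submodule F (KoszulM p a F) :=
  KoszulSupp p a F n ⊓ LinearMap.ker ((KoszulD p a F).restrictScalars F)

/-- The `n`-boundaries of the Koszul complex. -/
def KoszulB (p a : ℕ) (F : Type*) [Field F] (n : ℕ) : Submodule F (KoszulM p a F) :=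
  Submodule.map ((KoszulD p a F).restrictScalars F) (KoszulSupp p a F (n + 1))

/-- The `n`-th Koszul homology `H_n = Z_n / B_n`, realized as the image of the cycles in the
quotient of the Koszul complex by the boundaries. -/
def KoszulH (p a : ℕ) (F : Type*) [Field F] (n : ℕ) :
    Submodule F (KoszulM p a F ⧸ KoszulB p a F n) :=
  Submodule.map (KoszulB p a F n).mkQ (KoszulZ p a F n)


theorem kz_abstract {R N ι : Type*} [CommRing R] [AddCommGroup N] [Module R N] (p : ℕ)
    (hp : p.Prime) [CharP R p] (l : ι → R) (e : ι → N) (h : ∀ i j, l i • e j = l j • e i)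
    (f : ι → R) (s : Finset ι) :
    (∑ i ∈ s, f i * l i) ^ (p - 1) • (∑ i ∈ s, f i • e i) =
      ∑ i ∈ s, (f i) ^ p • (l i ^ (p - 1) • e i) := by
  classical
  -- two-term additivity
  have key : ∀ (x y : R) (u v : N), x • v = y • u →
      (x + y) ^ (p - 1) • (u + v) = x ^ (p - 1) • u + y ^ (p - 1) • v := by
    intro x y u v hxy
    obtain ⟨n, rfl⟩ : ∃ n, p = n + 1 := ⟨p - 1, by have := hp.pos; omega⟩
    simp only [Nat.add_sub_cancel]
    have hv : ∀ k m, x ^ (k + 1) • y ^ m • v = x ^ k • y ^ (m + 1) • u := by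
      intro k m
      rw [pow_succ, mul_smul, smul_comm x, hxy, pow_succ, mul_smul]
    rw [add_pow, smul_add, Finset.sum_smul, Finset.sum_smul, Finset.sum_range_succ,
      Finset.sum_range_succ']
    have : ∑ k ∈ Finset.range n, (x ^ k * y ^ (n - k) * (n.choose k : R)) • u +
        ∑ k ∈ Finset.range n, (x ^ (k + 1) * y ^ (n - (k + 1)) * (n.choose (k + 1) : R)) • v
        = 0 := by
      rw [← Finset.sum_add_distrib]
      apply Finset.sum_eq_zero
      intro k hk
      have hk := Finset.mem_range.1 hk
      have h1 : (x ^ (k + 1) * y ^ (n - (k + 1)) * (n.choose (k + 1) : R)) • v =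
          (x ^ k * y ^ (n - k) * (n.choose (k + 1) : R)) • u := by
        rw [mul_comm, mul_smul, mul_smul, hv, mul_comm, mul_smul, mul_smul,
          smul_comm ((n.choose (k + 1) : R)), smul_comm ((n.choose (k + 1) : R))]
        · rw [show n - (k + 1) + 1 = n - k by omega]
          simp only [smul_smul]
          ring_nf
      rw [h1, ← add_smul, ← mul_add, ← Nat.cast_add, ← Nat.choose_succ_succ,
        (CharP.cast_eq_zero_iff R (n + 1) _).2 (hp.dvd_choose_self (by omega) (by omega))]
      simp
    simp only [Nat.sub_self, pow_zero, Nat.choose_self, Nat.cast_one, mul_one, Nat.choose_zero_right,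
      Nat.sub_zero, one_mul]
    rw [add_add_add_comm, add_comm (x ^ n • u)] at *
    rw [add_right_comm, add_assoc] 
    rw [← sub_eq_zero]
    rw [← sub_eq_zero] at this
    rw [← this]
    abel
  induction s using Finset.induction_on with
  | empty => simp
  | insert j s hj ih =>
    rw [Finset.sum_insert hj, Finset.sum_insert hj, Finset.sum_insert hj, key, ih]
    · congr 1
      obtain ⟨n, rfl⟩ : ∃ n, p = n + 1 := ⟨p - 1, by have := hp.pos; omega⟩
      simp only [Nat.add_sub_cancel, smul_smul]
      congr 1
      ring
    · rw [Finset.smul_sum, Finset.sum_smul]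
      refine Finset.sum_congr rfl fun i _ => ?_
      rw [smul_comm, mul_smul, h j i, mul_smul, smul_comm (l i) (f j), smul_comm (f i) (f j)]

theorem kz_lam_pow (p a : ℕ) (F : Type*) [Field F] (i : Fin a) : Koszullam p a F i ^ p = 0 := by
  unfold Koszullam
  rw [← map_pow, Ideal.Quotient.eq_zero_iff_mem]
  exact Ideal.subset_span ⟨i, rfl⟩

/-- The ring map to the dual numbers dual to the `j`-th generator. -/
def kzTheta (p a : ℕ) (hp : p.Prime) (F : Type*) [Field F] (j : Fin a) :
    KoszulR p a F →ₐ[F] DualNumber F :=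
  Ideal.Quotient.liftₐ (KoszulJ p a F)
    (MvPolynomial.aeval fun i => if i = j then (DualNumber.eps : DualNumber F) else 0) (by
      intro x hx
      have : KoszulJ p a F ≤ RingHom.ker (MvPolynomial.aeval (R := F)
          fun i => if i = j then (DualNumber.eps : DualNumber F) else 0) := by
        unfold KoszulJ
        rw [Ideal.span_le]
        rintro _ ⟨i, rfl⟩
        have h2 : p = p - 2 + 2 := by have := hp.two_le; omega
        simp only [SetLike.mem_coe, RingHom.mem_ker, map_pow, MvPolynomial.aeval_X]
        rw [h2, pow_add]
        split_ifs <;> simp [DualNumber.eps_mul_eps, pow_two]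
      exact this hx)

theorem kzTheta_lam (p a : ℕ) (hp : p.Prime) (F : Type*) [Field F] (j i : Fin a) :
    kzTheta p a hp F j (Koszullam p a F i) = if i = j then DualNumber.eps else 0 := by
  unfold kzTheta Koszullam
  erw [Ideal.Quotient.lift_mk]
  simp

theorem kz_charP (p a : ℕ) (hp : p.Prime) (F : Type*) [Field F] [CharP F p] (j : Fin a) :
    CharP (KoszulR p a F) p := by
  have : Nontrivial (KoszulR p a F) := (kzTheta p a hp F j).toRingHom.domain_nontrivial
  exact charP_of_injective_algebraMap (algebraMap F (KoszulR p a F)).injective p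

theorem kz_pow (p a : ℕ) (hp : p.Prime) (F : Type*) [Field F] [CharP F p] (j : Fin a)
    (r : KoszulR p a F) :
    r ^ p = algebraMap F (KoszulR p a F) ((kzTheta p a hp F j r).fst ^ p) := by
  have := kz_charP p a hp F j
  have : Fact p.Prime := ⟨hp⟩
  obtain ⟨P, rfl⟩ := Ideal.Quotient.mk_surjective r
  induction P using MvPolynomial.induction_on with
  | C c =>
    have : (Ideal.Quotient.mk (KoszulJ p a F)) (MvPolynomial.C c) =
      algebraMap F (KoszulR p a F) c := rfl
    rw [this, AlgHom.commutes, map_pow]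
    rfl
  | add P Q hP hQ =>
    rw [map_add, add_pow_char, hP, hQ, map_add, TrivSqZeroExt.fst_add, add_pow_char, map_add]
  | mul_X P i hP =>
    rw [map_mul, mul_pow]
    have h1 : Ideal.Quotient.mk (KoszulJ p a F) (MvPolynomial.X i) = Koszullam p a F i := rfl
    rw [h1, kz_lam_pow, map_mul, kzTheta_lam, TrivSqZeroExt.fst_mul]
    have : (if i = j then (DualNumber.eps : DualNumber F) else 0).fst = 0 := by
      split_ifs <;> simp
    rw [this, mul_zero, mul_zero, zero_pow hp.ne_zero, map_zero]

/-- Boundaries in degree one as an `R`-submodule. -/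
def kzB (p a : ℕ) (F : Type*) [Field F] : Submodule (KoszulR p a F) (KoszulM p a F) :=
  Submodule.map (KoszulD p a F)
    (Finsupp.supported (KoszulR p a F) (KoszulR p a F) {s : Finset (Fin a) | s.card = 1 + 1})

theorem kz_mem_B (p a : ℕ) (F : Type*) [Field F] (x : KoszulM p a F) :
    x ∈ KoszulB p a F 1 ↔ x ∈ kzB p a F := by
  rfl

theorem kz_D_single (p a : ℕ) (F : Type*) [Field F] (s : Finset (Fin a)) (r : KoszulR p a F) :
    KoszulD p a F (Finsupp.single s r) = r • Koszulbd p a F s := by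
  simp only [KoszulD, Finsupp.lsum_apply]
  exact Finsupp.sum_single_index (map_zero _)

theorem kz_bd_one (p a : ℕ) (F : Type*) [Field F] (i : Fin a) :
    Koszulbd p a F {i} = Finsupp.single ∅ (Koszullam p a F i) := by
  unfold Koszulbd
  rw [Finset.sum_singleton]
  have : Finset.filter (fun j => j < i) {i} = ∅ := by ext; simp; intro h; simp [h]
  rw [this]
  simp

theorem kz_bd_two (p a : ℕ) (F : Type*) [Field F] (i j : Fin a) (h : i < j) :
    Koszulbd p a F {i, j} = Koszullam p a F i • Finsupp.single {j} 1 -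
      Koszullam p a F j • Finsupp.single {i} 1 := by
  unfold Koszulbd
  rw [Finset.sum_pair h.ne]
  have h1 : Finset.filter (fun k => k < i) {i, j} = ∅ := by
    ext k; simp; rintro (rfl | rfl); exacts [le_rfl, h.le]
  have h2 : Finset.filter (fun k => k < j) {i, j} = {i} := by
    ext k; simp
    constructor
    · rintro ⟨rfl | rfl, h⟩
      · rfl
      · exact absurd h (lt_irrefl _)
    · rintro rfl; exact ⟨Or.inl rfl, h⟩
  have h3 : ({i, j} : Finset (Fin a)).erase i = {j} := by
    rw [Finset.erase_insert]; simpa using h.ne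
  have h4 : ({i, j} : Finset (Fin a)).erase j = {i} := by
    rw [Finset.pair_comm, Finset.erase_insert]; simpa using h.ne'
  rw [h1, h2, h3, h4, Finset.card_empty, Finset.card_singleton, pow_zero, pow_one, one_smul,
    neg_smul, one_smul, sub_eq_add_neg]

theorem kz_rel (p a : ℕ) (F : Type*) [Field F] (i j : Fin a) :
    Koszullam p a F i • (kzB p a F).mkQ (Finsupp.single {j} 1) =
      Koszullam p a F j • (kzB p a F).mkQ (Finsupp.single {i} 1) := by
  have main : ∀ i j : Fin a, i < j →
    Koszullam p a F i • (kzB p a F).mkQ (Finsupp.single {j} 1) =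
      Koszullam p a F j • (kzB p a F).mkQ (Finsupp.single {i} 1) := by
    intro i j h
    rw [← map_smul, ← map_smul, ← sub_eq_zero, ← map_sub, ← kz_bd_two p a F i j h]
    rw [Submodule.mkQ_apply, Submodule.Quotient.mk_eq_zero]
    refine ⟨Finsupp.single {i, j} 1, ?_, ?_⟩
    · apply Finsupp.single_mem_supported
      simp [Finset.card_pair h.ne]
    · rw [kz_D_single, one_smul]
  rcases lt_trichotomy i j with h | h | h
  · exact main i j h
  · rw [h]
  · exact (main j i h).symm

theorem kz_decomp (p a : ℕ) (F : Type*) [Field F] (z : KoszulM p a F)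
    (hz : z ∈ Finsupp.supported (KoszulR p a F) (KoszulR p a F)
      {s : Finset (Fin a) | s.card = 1}) :
    z = ∑ i : Fin a, z {i} • Finsupp.single ({i} : Finset (Fin a)) (1 : KoszulR p a F) := by
  ext s
  rw [Finsupp.finsetSum_apply]
  simp only [Finsupp.smul_apply, smul_eq_mul]
  by_cases hs : s.card = 1
  · obtain ⟨j, rfl⟩ := Finset.card_eq_one.1 hs
    rw [Finset.sum_eq_single j]
    · simp
    · intro b _ hb
      rw [Finsupp.single_eq_of_ne (by simpa using hb.symm), mul_zero]
    · simp
  · rw [Finset.sum_eq_zero]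
    · by_contra hne
      exact hs (hz (Finsupp.mem_support_iff.2 hne))
    · intro i _
      rw [Finsupp.single_eq_of_ne, mul_zero]
      rintro rfl
      simp at hs

theorem kz_main (p a : ℕ) (hp : p.Prime) (ha : 1 ≤ a) (F : Type*) [Field F] [CharP F p]
    (lamEl : KoszulR p a F)
    (z : KoszulM p a F)
    (hz : z ∈ Finsupp.supported (KoszulR p a F) (KoszulR p a F)
      {s : Finset (Fin a) | s.card = 1})
    (hdz : KoszulD p a F z = Finsupp.single (∅ : Finset (Fin a)) lamEl)
    (mu : Fin a → F)
    (hmu : lamEl - ∑ i : Fin a, mu i • Koszullam p a F i ∈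
      (Ideal.span (Set.range (Koszullam p a F))) ^ 2) :
    lamEl ^ p = 0 ∧
    lamEl ^ (p - 1) • z - ∑ i : Fin a, mu i ^ p •
          (Koszullam p a F i ^ (p - 1) •
            Finsupp.single ({i} : Finset (Fin a)) (1 : KoszulR p a F)) ∈ kzB p a F := by
  have : Fact p.Prime := ⟨hp⟩
  have : CharP (KoszulR p a F) p := kz_charP p a hp F ⟨0, ha⟩
  have hzd := kz_decomp p a F z hz
  set f : Fin a → KoszulR p a F := fun i => z {i} with hf
  have hl : lamEl = ∑ i, f i * Koszullam p a F i := by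
    have h1 := hdz
    rw [hzd, map_sum] at h1
    have h2 := DFunLike.congr_fun h1 ∅
    rw [Finsupp.finsetSum_apply] at h2
    simp only [map_smul, kz_D_single, kz_bd_one, one_smul, Finsupp.smul_apply, smul_eq_mul,
      Finsupp.single_eq_same] at h2
    exact h2.symm
  refine ⟨?_, ?_⟩
  · rw [hl, sum_pow_char]
    refine Finset.sum_eq_zero fun i _ => ?_
    rw [mul_pow, kz_lam_pow, mul_zero]
  have hmuf : ∀ j, (kzTheta p a hp F j (f j)).fst = mu j := by
    intro j
    have h0 : kzTheta p a hp F j (lamEl - ∑ i : Fin a, mu i • Koszullam p a F i) = 0 := by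
      have hle : Ideal.span (Set.range (Koszullam p a F)) ≤
          Ideal.comap (kzTheta p a hp F j) (Ideal.span {DualNumber.eps}) := by
        rw [Ideal.span_le]
        rintro _ ⟨i, rfl⟩
        rw [SetLike.mem_coe, Ideal.mem_comap, kzTheta_lam]
        split_ifs
        · exact Ideal.subset_span rfl
        · exact zero_mem _
      have h3 := (Ideal.pow_right_mono hle 2).trans (Ideal.le_comap_pow _ 2) hmu
      rw [Ideal.mem_comap, Ideal.span_singleton_pow, pow_two, DualNumber.eps_mul_eps,
        Ideal.span_singleton_eq_bot.2 rfl] at h3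
      exact h3
    rw [map_sub, hl, map_sum, map_sum, sub_eq_zero] at h0
    simp only [map_mul, map_smul, kzTheta_lam, mul_ite, mul_zero, smul_ite, smul_zero,
      Finset.sum_ite_eq', Finset.mem_univ, if_true] at h0
    have h4 := congrArg TrivSqZeroExt.snd h0
    simpa using h4
  rw [← Submodule.Quotient.mk_eq_zero, ← Submodule.mkQ_apply, map_sub, sub_eq_zero, map_smul]
  have habs := kz_abstract p hp (Koszullam p a F)
    (fun i => (kzB p a F).mkQ (Finsupp.single ({i} : Finset (Fin a)) (1 : KoszulR p a F)))
    (kz_rel p a F) f Finset.univ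
  rw [← hl] at habs
  have hq : (kzB p a F).mkQ z = ∑ i, f i •
      (kzB p a F).mkQ (Finsupp.single ({i} : Finset (Fin a)) (1 : KoszulR p a F)) := by
    conv_lhs => rw [hzd]
    simp only [map_sum, map_smul, hf]
  rw [hq, habs, map_sum]
  refine Finset.sum_congr rfl fun i _ => ?_
  rw [kz_pow p a hp F i (f i), hmuf, ← map_smul, ← map_smul, algebraMap_smul]

/-- Let `p` be prime, `a ≥ 1`, `F` a field of characteristic `p`,
`R = F[λ_1, …, λ_a]/(λ_1^p, …, λ_a^p)` with maximal ideal `I = (λ_1, …, λ_a)`, and `K_*` the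
Koszul complex of `R` on `(λ_1, …, λ_a)`.  Let `λ ∈ I` and let `z ∈ K_1` be any element with
`d z = λ`.  Then `λ^{p-1} z` is a cycle whose class in `H_1(K_*)` equals
`μ_1^p [λ_1^{p-1} z_1] + ⋯ + μ_a^p [λ_a^{p-1} z_a]`, where the `μ_i ∈ F` are determined by
`λ ≡ μ_1 λ_1 + ⋯ + μ_a λ_a (mod I²)`.  In particular the class is independent of the choice
of `z`. -/
theorem stmt_15 (p a : ℕ) (hp : p.Prime) (ha : 1 ≤ a) (F : Type*) [Field F] [CharP F p]
    (lamEl : KoszulR p a F)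
    (hlamEl : lamEl ∈ Ideal.span (Set.range (Koszullam p a F)))
    (z : KoszulM p a F)
    (hz : z ∈ Finsupp.supported (KoszulR p a F) (KoszulR p a F)
      {s : Finset (Fin a) | s.card = 1})
    (hdz : KoszulD p a F z = Finsupp.single (∅ : Finset (Fin a)) lamEl)
    (mu : Fin a → F)
    (hmu : lamEl - ∑ i : Fin a, mu i • Koszullam p a F i ∈
      (Ideal.span (Set.range (Koszullam p a F))) ^ 2) :
    (lamEl ^ (p - 1) • z ∈ KoszulZ p a F 1) ∧
    (∀ i : Fin a,
      (Koszullam p a F i ^ (p - 1) •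
        Finsupp.single ({i} : Finset (Fin a)) (1 : KoszulR p a F) : KoszulM p a F)
        ∈ KoszulZ p a F 1) ∧
    (Submodule.Quotient.mk (lamEl ^ (p - 1) • z) : KoszulM p a F ⧸ KoszulB p a F 1) =
      ∑ i : Fin a, mu i ^ p •
        (Submodule.Quotient.mk
          (Koszullam p a F i ^ (p - 1) •
            Finsupp.single ({i} : Finset (Fin a)) (1 : KoszulR p a F)) :
          KoszulM p a F ⧸ KoszulB p a F 1) := by
  have hsupp : ∀ i : Fin a, (Finsupp.single ({i} : Finset (Fin a)) (1 : KoszulR p a F)) ∈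
      Finsupp.supported (KoszulR p a F) (KoszulR p a F) {s : Finset (Fin a) | s.card = 1} :=
    fun i => Finsupp.single_mem_supported _ _ (by simp)
  have hpp : p - 1 + 1 = p := Nat.sub_add_cancel hp.pos
  obtain ⟨h1, h2⟩ := kz_main p a hp ha F lamEl z hz hdz mu hmu
  refine ⟨⟨Submodule.smul_mem _ _ hz, ?_⟩, fun i => ⟨Submodule.smul_mem _ _ (hsupp i), ?_⟩, ?_⟩
  · change KoszulD p a F _ = 0
    rw [map_smul, hdz, Finsupp.smul_single, smul_eq_mul, ← pow_succ, hpp, h1,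
      Finsupp.single_zero]
  · change KoszulD p a F _ = 0
    rw [map_smul, kz_D_single, one_smul, kz_bd_one, Finsupp.smul_single, smul_eq_mul, ← pow_succ,
      hpp, kz_lam_pow, Finsupp.single_zero]
  · have h3 := (kz_mem_B p a F _).2 h2
    rw [← Submodule.Quotient.mk_eq_zero, Submodule.Quotient.mk_sub, sub_eq_zero] at h3
    rw [h3, ← Submodule.mkQ_apply, map_sum]
    rfl
end
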